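/- Let φ : 𝔻 → 𝔻 be holomorphic, and suppose that for every h ∈ H² the operator f ↦ h·(f∘φ) is bounded on H² (i.e. M_φ = H²). Then ‖φ‖_∞ < 1. -/

import Mathlib

open Complex Metric MeasureTheory

/-- The set of integral means `(2π)⁻¹ ∫₀^{2π} ‖g(r e^{iθ})‖² dθ`, `0 ≤ r < 1`. -/
noncomputable def hardyMeans (g : ℂ → ℂ) : Set ℝ :=
  {x | ∃ r : ℝ, 0 ≤ r ∧ r < 1 ∧
    x = (2 * Real.pi)⁻¹ *
      ∫ θ in (0:ℝ)..(2 * Real.pi), ‖g (r * Complex.exp ((θ : ℂ) * Complex.I))‖ ^ 2}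

/-- Membership in the Hardy space `H²` of the unit disc. -/
def MemHardy2 (g : ℂ → ℂ) : Prop :=
  DifferentiableOn ℂ g (ball (0:ℂ) 1) ∧ BddAbove (hardyMeans g)

/-- The squared `H²` norm, as the supremum of the integral means. -/
noncomputable def hardySq (g : ℂ → ℂ) : ℝ := sSup (hardyMeans g)


theorem point_bound (g : ℂ → ℂ) (hg : MemHardy2 g) (z : ℂ) (hz : z ∈ ball (0:ℂ) 1) :
    ‖g z‖ ^ 2 * (1 - ‖z‖) ≤ hardySq g := by
  have hz1 : ‖z‖ < 1 := by simpa using hz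
  have key : ∀ R : ℝ, ‖z‖ < R → R < 1 → ‖g z‖ ^ 2 * (R - ‖z‖) ≤ hardySq g := by
    intro R hR hR1
    have hR0 : 0 < R := lt_of_le_of_lt (norm_nonneg z) hR
    have hsub : closedBall (0:ℂ) R ⊆ ball (0:ℂ) 1 := closedBall_subset_ball hR1
    have hd : DifferentiableOn ℂ (fun w => g w ^ 2) (closedBall (0:ℂ) R) :=
      (hg.1.mono hsub).pow 2
    have hc := hd.circleIntegral_sub_inv_smul (w := z) (by simpa using hR)
    have hgc : Continuous (fun θ : ℝ => g (R * Complex.exp ((θ : ℂ) * Complex.I))) := by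
      apply hg.1.continuousOn.comp_continuous (by fun_prop)
      intro θ
      simp [Complex.norm_exp_ofReal_mul_I, abs_of_pos hR0, hR1]
    set I : ℝ := ∫ θ in (0:ℝ)..(2 * Real.pi), ‖g (R * Complex.exp ((θ : ℂ) * Complex.I))‖ ^ 2 with hI
    have hb : ‖∮ w in C(0, R), (w - z)⁻¹ • g w ^ 2‖ ≤ R / (R - ‖z‖) * I := by
      rw [circleIntegral, hI, ← intervalIntegral.integral_const_mul]
      apply intervalIntegral.norm_integral_le_of_norm_le Real.two_pi_pos.le
      · refine Filter.Eventually.of_forall fun θ _ => ?_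
        simp only [deriv_circleMap, circleMap, zero_add, norm_smul, norm_mul, norm_inv, norm_pow,
          Complex.norm_exp_ofReal_mul_I, Complex.norm_I, mul_one, Complex.norm_real,
          Real.norm_eq_abs, abs_of_pos hR0, div_eq_mul_inv, mul_assoc]
        have : R - ‖z‖ ≤ ‖(R:ℂ) * Complex.exp ((θ : ℂ) * Complex.I) - z‖ := by
          have := norm_sub_norm_le ((R:ℂ) * Complex.exp ((θ : ℂ) * Complex.I)) z
          simpa [Complex.norm_exp_ofReal_mul_I, abs_of_pos hR0] using this
        have h0 : 0 < R - ‖z‖ := by linarith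
        gcongr
      · exact (continuous_const.mul (hgc.norm.pow 2)).intervalIntegrable _ _
    have hm : (2 * Real.pi)⁻¹ * I ≤ hardySq g := le_csSup hg.2 ⟨R, hR0.le, hR1, rfl⟩
    rw [hc, norm_smul] at hb
    have h2 : ‖(2 * (Real.pi:ℂ) * Complex.I)‖ = 2 * Real.pi := by
      simp [abs_of_pos Real.pi_pos]
    rw [h2, norm_pow, div_mul_eq_mul_div, le_div_iff₀ (by linarith)] at hb
    have hI0 : 0 ≤ I := intervalIntegral.integral_nonneg Real.two_pi_pos.le fun _ _ => by positivity
    have h3 : 2 * Real.pi * ‖g z‖ ^ 2 * (R - ‖z‖) ≤ I := hb.trans (by nlinarith)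
    refine le_trans ?_ hm
    rw [inv_mul_eq_div, le_div_iff₀ Real.two_pi_pos]
    linarith
  have ht : Filter.Tendsto (fun R : ℝ => ‖g z‖ ^ 2 * (R - ‖z‖)) (nhdsWithin 1 (Set.Iio 1))
      (nhds (‖g z‖ ^ 2 * (1 - ‖z‖))) := by
    apply Filter.Tendsto.mono_left _ nhdsWithin_le_nhds
    apply Continuous.tendsto (by fun_prop)
  refine le_of_tendsto ht ?_
  filter_upwards [Ioo_mem_nhdsLT hz1] with R hR
  exact key R hR.1 hR.2

theorem one_sub_ne {a w : ℂ} (ha : ‖a‖ < 1) (hw : ‖w‖ < 1) :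
    1 - (starRingEnd ℂ) a * w ≠ 0 := by
  intro h
  have h1 : (starRingEnd ℂ) a * w = 1 := (sub_eq_zero.mp h).symm
  have h2 := congrArg norm h1
  rw [norm_mul, RCLike.norm_conj, norm_one] at h2
  nlinarith [norm_nonneg a, norm_nonneg w]

theorem kernel_diff {a : ℂ} (ha : ‖a‖ < 1) :
    DifferentiableOn ℂ (fun w => (1 - (starRingEnd ℂ) a * w)⁻¹) (ball (0:ℂ) 1) := by
  apply DifferentiableOn.inv (by fun_prop)
  intro w hw
  exact one_sub_ne ha (by simpa using hw)

theorem kernel_mean {a : ℂ} (ha : ‖a‖ < 1) {r : ℝ} (hr : 0 ≤ r) (hr1 : r < 1) :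
    (2 * Real.pi)⁻¹ * ∫ θ in (0:ℝ)..(2 * Real.pi),
      ‖(1 - (starRingEnd ℂ) a * (r * Complex.exp ((θ : ℂ) * Complex.I)))⁻¹‖ ^ 2
      ≤ (1 - ‖a‖ ^ 2)⁻¹ := by
  have ha0 := norm_nonneg a
  have hA : 0 < 1 - ‖a‖ ^ 2 := by nlinarith
  have hpi := Real.pi_pos
  rcases hr.eq_or_lt with rfl | hr0
  · simp only [Complex.ofReal_zero, zero_mul, mul_zero, sub_zero, inv_one, norm_one, one_pow]
    rw [intervalIntegral.integral_const]
    simp only [sub_zero, smul_eq_mul, mul_one]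
    rw [inv_mul_cancel₀ (by positivity)]
    exact (one_le_inv₀ hA).2 (by nlinarith)
  have hd : DifferentiableOn ℂ (fun w => (1 - (starRingEnd ℂ) a * w)⁻¹) (closedBall (0:ℂ) r) :=
    (kernel_diff ha).mono (closedBall_subset_ball hr1)
  have hc := hd.circleIntegral_sub_inv_smul (w := a * r ^ 2) (by
    simp only [mem_ball_zero_iff, norm_mul, norm_pow, Complex.norm_real, Real.norm_eq_abs, abs_of_pos hr0]
    nlinarith [mul_pos hr0 hr0])
  have he : ∀ θ : ℝ, deriv (circleMap 0 r) θ • ((circleMap 0 r θ - a * r ^ 2)⁻¹ •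
      (1 - (starRingEnd ℂ) a * circleMap 0 r θ)⁻¹) = Complex.I *
      ((‖(1 - (starRingEnd ℂ) a * (r * Complex.exp ((θ : ℂ) * Complex.I)))⁻¹‖ ^ 2 : ℝ) : ℂ) := by
    intro θ
    rw [deriv_circleMap]
    simp only [circleMap, zero_add, smul_eq_mul]
    set w : ℂ := r * Complex.exp ((θ : ℂ) * Complex.I) with hw
    have hwn : ‖w‖ = r := by
      simp [hw, Complex.norm_exp_ofReal_mul_I, abs_of_pos hr0]
    have hww : w * (starRingEnd ℂ) w = (r:ℂ) ^ 2 := by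
      rw [Complex.mul_conj', hwn]
    have hne := one_sub_ne ha (hwn ▸ hr1)
    have hne2 : (starRingEnd ℂ) (1 - (starRingEnd ℂ) a * w) ≠ 0 := by
      simpa only [ne_eq, map_eq_zero] using hne
    have hw0 : w ≠ 0 := by
      rw [← norm_pos_iff, hwn]; exact hr0
    have h3 : w - a * r ^ 2 = w * (starRingEnd ℂ) (1 - (starRingEnd ℂ) a * w) := by
      simp only [map_sub, map_one, map_mul, Complex.conj_conj]
      rw [← hww]; ring
    rw [h3]
    push_cast
    rw [← Complex.mul_conj', map_inv₀]
    field_simp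
  simp only [circleIntegral, he] at hc
  rw [intervalIntegral.integral_const_mul, intervalIntegral.integral_ofReal] at hc
  set J : ℝ := ∫ θ in (0:ℝ)..(2 * Real.pi),
      ‖(1 - (starRingEnd ℂ) a * (r * Complex.exp ((θ : ℂ) * Complex.I)))⁻¹‖ ^ 2
  have h4 : (J : ℂ) = ((2 * Real.pi * (1 - ‖a‖ ^ 2 * r ^ 2)⁻¹ : ℝ) : ℂ) := by
    apply mul_left_cancel₀ Complex.I_ne_zero
    rw [hc]
    push_cast
    rw [← Complex.conj_mul']
    simp only [smul_eq_mul]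
    ring
  have h5 := Complex.ofReal_injective h4
  rw [h5, ← mul_assoc, inv_mul_cancel₀ (by positivity), one_mul]
  apply inv_anti₀ hA
  nlinarith [mul_nonneg (sq_nonneg ‖a‖) (by nlinarith : (0:ℝ) ≤ 1 - r ^ 2)]

theorem kernel_mem {a : ℂ} (ha : ‖a‖ < 1) :
    MemHardy2 (fun w => (1 - (starRingEnd ℂ) a * w)⁻¹) := by
  refine ⟨kernel_diff ha, (1 - ‖a‖ ^ 2)⁻¹, ?_⟩
  rintro x ⟨r, h0, h1, rfl⟩
  exact kernel_mean ha h0 h1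

theorem kernel_sq {a : ℂ} (ha : ‖a‖ < 1) :
    hardySq (fun w => (1 - (starRingEnd ℂ) a * w)⁻¹) ≤ (1 - ‖a‖ ^ 2)⁻¹ := by
  refine csSup_le (s := hardyMeans _) ⟨_, ⟨0, le_rfl, one_pos, rfl⟩⟩ ?_
  rintro x ⟨r, h0, h1, rfl⟩
  exact kernel_mean ha h0 h1

theorem series_mem (e : ℕ → ℂ → ℂ) (hd : ∀ n, DifferentiableOn ℂ (e n) (ball (0:ℂ) 1))
    (hm : ∀ n, ∀ r : ℝ, 0 ≤ r → r < 1 → (2 * Real.pi)⁻¹ *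
      ∫ θ in (0:ℝ)..(2 * Real.pi), ‖e n (r * Complex.exp ((θ : ℂ) * Complex.I))‖ ^ 2 ≤ 1)
    (hb : ∀ n w, ‖w‖ < 1 → ‖e n w‖ ≤ (1 - ‖w‖)⁻¹) :
    MemHardy2 (fun w => ∑' n, ((1/2 : ℝ) ^ n : ℝ) * e n w) := by
  have hq : HasSum (fun n : ℕ => (1/2 : ℝ) ^ n) 2 := hasSum_geometric_two
  have hdiff : DifferentiableOn ℂ (fun w => ∑' n, ((1/2 : ℝ) ^ n : ℝ) * e n w) (ball (0:ℂ) 1) := by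
    intro w hw
    have hw1 : ‖w‖ < 1 := by simpa using hw
    obtain ⟨ρ, h1, h2⟩ := exists_between hw1
    have hD : DifferentiableOn ℂ (fun w => ∑' n, ((1/2 : ℝ) ^ n : ℝ) * e n w) (ball (0:ℂ) ρ) := by
      refine Complex.differentiableOn_tsum_of_summable_norm
        (u := fun n => (1/2 : ℝ) ^ n * (1 - ρ)⁻¹)
        (hq.summable.mul_right _) (fun n => ?_) isOpen_ball (fun n v hv => ?_)
      · exact ((hd n).mono (ball_subset_ball h2.le)).const_mul _
      · have hv1 : ‖v‖ < ρ := by simpa using hv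
        rw [norm_mul, Complex.norm_real, Real.norm_of_nonneg (by positivity)]
        have := hb n v (hv1.trans h2)
        have h3 : (1 - ‖v‖)⁻¹ ≤ (1 - ρ)⁻¹ := inv_anti₀ (by linarith) (by linarith)
        gcongr
        exact this.trans h3
    exact (hD.differentiableAt (isOpen_ball.mem_nhds (by simpa using h1))).differentiableWithinAt
  refine ⟨hdiff, 4, ?_⟩
  rintro x ⟨r, hr, hr1, rfl⟩
  have hnorm : ∀ θ : ℝ, ‖(r:ℂ) * Complex.exp ((θ : ℂ) * Complex.I)‖ = r := by
    intro θ; simp [Complex.norm_exp_ofReal_mul_I, abs_of_nonneg hr]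
  have hcont : ∀ g : ℂ → ℂ, DifferentiableOn ℂ g (ball (0:ℂ) 1) →
      Continuous (fun θ : ℝ => g (r * Complex.exp ((θ : ℂ) * Complex.I))) := by
    intro g hg
    apply hg.continuousOn.comp_continuous (by fun_prop)
    intro θ
    rw [mem_ball_zero_iff, hnorm]; exact hr1
  set B : ℝ := (1 - r)⁻¹ with hB
  have hB0 : 0 ≤ B := by rw [hB]; exact inv_nonneg.2 (by linarith)
  have hbd : ∀ n (θ : ℝ), ‖e n (r * Complex.exp ((θ : ℂ) * Complex.I))‖ ≤ B := by
    intro n θ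
    have := hb n (r * Complex.exp ((θ : ℂ) * Complex.I)) (by rw [hnorm]; exact hr1)
    rwa [hnorm] at this
  have hs2 : ∀ θ : ℝ, Summable fun n : ℕ =>
      (1/2 : ℝ) ^ n * ‖e n (r * Complex.exp ((θ : ℂ) * Complex.I))‖ ^ 2 := by
    intro θ
    refine Summable.of_nonneg_of_le (fun n => by positivity) (fun n => ?_)
      (hq.summable.mul_right (B ^ 2))
    have := hbd n θ
    gcongr
  have hs1 : ∀ θ : ℝ, Summable fun n : ℕ =>
      (1/2 : ℝ) ^ n * ‖e n (r * Complex.exp ((θ : ℂ) * Complex.I))‖ := by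
    intro θ
    refine Summable.of_nonneg_of_le (fun n => by positivity) (fun n => ?_)
      (hq.summable.mul_right B)
    have := hbd n θ
    gcongr
  have hpt : ∀ θ : ℝ,
      ‖∑' n, (((1/2 : ℝ) ^ n : ℝ) : ℂ) * e n (r * Complex.exp ((θ : ℂ) * Complex.I))‖ ^ 2 ≤
      2 * ∑' n, (1/2 : ℝ) ^ n * ‖e n (r * Complex.exp ((θ : ℂ) * Complex.I))‖ ^ 2 := by
    intro θ
    set E : ℕ → ℂ := fun n => e n (r * Complex.exp ((θ : ℂ) * Complex.I)) with hE
    have hn : ∀ n, ‖(((1/2 : ℝ) ^ n : ℝ) : ℂ) * E n‖ = (1/2 : ℝ) ^ n * ‖E n‖ := by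
      intro n
      rw [norm_mul, Complex.norm_real, Real.norm_of_nonneg (by positivity)]
    have hle : ‖∑' n, (((1/2 : ℝ) ^ n : ℝ) : ℂ) * E n‖ ≤ ∑' n, (1/2 : ℝ) ^ n * ‖E n‖ := by
      have := norm_tsum_le_tsum_norm (f := fun n => (((1/2 : ℝ) ^ n : ℝ) : ℂ) * E n)
        (by simp only [hn]; exact hs1 θ)
      simpa only [hn] using this
    have hS := (hs1 θ).hasSum
    have hT := (hs2 θ).hasSum
    set S := ∑' n, (1/2 : ℝ) ^ n * ‖E n‖ with hSdef
    set T := ∑' n, (1/2 : ℝ) ^ n * ‖E n‖ ^ 2 with hTdef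
    have h1 : HasSum (fun n => (1/2 : ℝ) ^ n * (‖E n‖ - S / 2) ^ 2)
        (T - S * S + (S / 2) ^ 2 * 2) := by
      have := (hT.sub (hS.mul_left S)).add (hq.mul_left ((S / 2) ^ 2))
      refine this.congr_fun ?_
      intro n
      ring
    have h2 : 0 ≤ T - S * S + (S / 2) ^ 2 * 2 := h1.nonneg fun n => by positivity
    calc _ ≤ S ^ 2 := by gcongr
      _ ≤ 2 * T := by nlinarith
  have hint : HasSum (fun n => ∫ θ in (0:ℝ)..(2 * Real.pi),
        (1/2 : ℝ) ^ n * ‖e n (r * Complex.exp ((θ : ℂ) * Complex.I))‖ ^ 2)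
      (∫ θ in (0:ℝ)..(2 * Real.pi),
        ∑' n, (1/2 : ℝ) ^ n * ‖e n (r * Complex.exp ((θ : ℂ) * Complex.I))‖ ^ 2) := by
    refine intervalIntegral.hasSum_integral_of_dominated_convergence
      (fun n _ => (1/2 : ℝ) ^ n * B ^ 2) (fun n => ?_) (fun n => ?_) ?_ ?_ ?_
    · exact (continuous_const.mul ((hcont _ (hd n)).norm.pow 2)).aestronglyMeasurable
    · refine Filter.Eventually.of_forall fun θ _ => ?_
      rw [Real.norm_of_nonneg (by positivity)]
      have := hbd n θ
      gcongr
    · exact Filter.Eventually.of_forall fun θ _ => hq.summable.mul_right _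
    · exact continuous_const.intervalIntegrable _ _
    · exact Filter.Eventually.of_forall fun θ _ => (hs2 θ).hasSum
  have hcT : Continuous fun θ : ℝ =>
      ∑' n, (1/2 : ℝ) ^ n * ‖e n (r * Complex.exp ((θ : ℂ) * Complex.I))‖ ^ 2 := by
    refine continuous_tsum (u := fun n => (1/2 : ℝ) ^ n * B ^ 2)
      (fun n => continuous_const.mul ((hcont _ (hd n)).norm.pow 2))
      (hq.summable.mul_right _) (fun n θ => ?_)
    rw [Real.norm_of_nonneg (by positivity)]
    have := hbd n θ
    gcongr
  have hmono := intervalIntegral.integral_mono_on (μ := volume) Real.two_pi_pos.le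
    (((hcont _ hdiff).norm.pow 2).intervalIntegrable _ _)
    ((continuous_const.mul hcT).intervalIntegrable _ _) (fun θ _ => hpt θ)
  simp only [Pi.mul_apply, Pi.pow_apply, intervalIntegral.integral_const_mul] at hmono
  have hle : (∫ θ in (0:ℝ)..(2 * Real.pi),
        ∑' n, (1/2 : ℝ) ^ n * ‖e n (r * Complex.exp ((θ : ℂ) * Complex.I))‖ ^ 2) ≤
        2 * (2 * Real.pi) := by
    refine hasSum_le (fun n => ?_) hint (hq.mul_right (2 * Real.pi))
    rw [intervalIntegral.integral_const_mul]
    have := hm n r hr hr1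
    rw [inv_mul_le_iff₀ Real.two_pi_pos, mul_one] at this
    gcongr
  rw [inv_mul_le_iff₀ Real.two_pi_pos]
  refine hmono.trans ?_
  linarith

theorem kernel_lower {a w : ℂ} (ha : ‖a‖ < 1) (hw : ‖w‖ < 1) :
    1 - ‖w‖ ≤ ‖1 - (starRingEnd ℂ) a * w‖ := by
  have := norm_sub_norm_le (1:ℂ) ((starRingEnd ℂ) a * w)
  rw [norm_mul, RCLike.norm_conj, norm_one] at this
  nlinarith [norm_nonneg a, norm_nonneg w]

theorem kernel_re {a w : ℂ} (ha : ‖a‖ < 1) (hw : ‖w‖ < 1) :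
    0 ≤ ((1 - (starRingEnd ℂ) a * w)⁻¹).re := by
  rw [Complex.inv_re]
  apply div_nonneg _ (Complex.normSq_nonneg _)
  have h := Complex.re_le_norm ((starRingEnd ℂ) a * w)
  rw [norm_mul, RCLike.norm_conj] at h
  rw [Complex.sub_re, Complex.one_re]
  nlinarith [norm_nonneg a, norm_nonneg w]

theorem kernel_self (a : ℂ) : (1 - (starRingEnd ℂ) a * a)⁻¹ = (((1 - ‖a‖ ^ 2)⁻¹ : ℝ) : ℂ) := by
  rw [Complex.conj_mul']; push_cast; rfl

/-- If for every `h ∈ H²` the weighted composition operator `f ↦ h · (f ∘ φ)` is bounded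
on `H²` (i.e. `M_φ = H²`), then `‖φ‖_∞ < 1`. -/
theorem stmt6 (φ : ℂ → ℂ)
    (hφd : DifferentiableOn ℂ φ (ball (0:ℂ) 1))
    (hφmaps : Set.MapsTo φ (ball (0:ℂ) 1) (ball (0:ℂ) 1))
    (hyp : ∀ h : ℂ → ℂ, MemHardy2 h → ∃ C : ℝ, ∀ f : ℂ → ℂ, MemHardy2 f →
        MemHardy2 (fun z => h z * f (φ z)) ∧
        hardySq (fun z => h z * f (φ z)) ≤ C * hardySq f) :
    ∃ r : ℝ, r < 1 ∧ ∀ z ∈ ball (0:ℂ) 1, ‖φ z‖ ≤ r := by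
  by_contra hcon
  push Not at hcon
  have hz : ∀ n : ℕ, ∃ z ∈ ball (0:ℂ) 1, 1 - (1/8 : ℝ) ^ n < ‖φ z‖ := fun n =>
    hcon _ (by have : (0:ℝ) < (1/8 : ℝ) ^ n := by positivity
               linarith)
  choose z hzb hzφ using hz
  have hz1 : ∀ n, ‖z n‖ < 1 := fun n => by simpa using hzb n
  have hpos : ∀ n, 0 < 1 - ‖z n‖ ^ 2 := fun n => by nlinarith [hz1 n, norm_nonneg (z n)]
  set e : ℕ → ℂ → ℂ := fun n w =>
    (√(1 - ‖z n‖ ^ 2) : ℂ) * (1 - (starRingEnd ℂ) (z n) * w)⁻¹ with he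
  have hen : ∀ n w, ‖e n w‖ = √(1 - ‖z n‖ ^ 2) * ‖(1 - (starRingEnd ℂ) (z n) * w)⁻¹‖ := by
    intro n w
    rw [he]
    simp only [norm_mul, Complex.norm_real, Real.norm_of_nonneg (Real.sqrt_nonneg _)]
  have hbe : ∀ n w, ‖w‖ < 1 → ‖e n w‖ ≤ (1 - ‖w‖)⁻¹ := by
    intro n w hw
    rw [hen, norm_inv]
    have h1 : √(1 - ‖z n‖ ^ 2) ≤ 1 := Real.sqrt_le_one.2 (by nlinarith [norm_nonneg (z n)])
    have h2 := inv_anti₀ (by linarith) (kernel_lower (hz1 n) hw)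
    exact (mul_le_of_le_one_left (by positivity) h1).trans h2
  have hmem := series_mem e (fun n => (kernel_diff (hz1 n)).const_mul _) (by
    intro n r hr hr1
    have hk := kernel_mean (hz1 n) hr hr1
    simp only [hen, mul_pow, Real.sq_sqrt (hpos n).le]
    rw [intervalIntegral.integral_const_mul, mul_left_comm]
    have := mul_le_mul_of_nonneg_left hk (hpos n).le
    rwa [mul_inv_cancel₀ (hpos n).ne'] at this) hbe
  set h : ℂ → ℂ := fun w => ∑' n, ((1/2 : ℝ) ^ n : ℝ) * e n w with hh
  have hlow : ∀ n, (1/2 : ℝ) ^ n * (√(1 - ‖z n‖ ^ 2) * (1 - ‖z n‖ ^ 2)⁻¹) ≤ ‖h (z n)‖ := by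
    intro n
    refine le_trans ?_ (Complex.re_le_norm _)
    have hs : Summable fun k => (((1/2 : ℝ) ^ k : ℝ) : ℂ) * e k (z n) := by
      refine Summable.of_norm_bounded (summable_geometric_two.mul_right (1 - ‖z n‖)⁻¹) fun k => ?_
      rw [norm_mul, Complex.norm_real, Real.norm_of_nonneg (by positivity)]
      have := hbe k _ (hz1 n)
      gcongr
    have hre := Complex.hasSum_re hs.hasSum
    have hterm := le_hasSum hre n (fun k _ => by
      simp only [he]
      rw [Complex.re_ofReal_mul, Complex.re_ofReal_mul]
      have := kernel_re (hz1 k) (hz1 n)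
      positivity)
    refine le_trans (le_of_eq ?_) hterm
    simp only [he]
    rw [Complex.re_ofReal_mul, Complex.re_ofReal_mul, kernel_self, Complex.ofReal_re]
  obtain ⟨C, hC⟩ := hyp h hmem
  have hfin : ∀ n : ℕ, (2:ℝ) ^ n ≤ 4 * |C| := by
    intro n
    set a := φ (z n) with ha
    have ha1 : ‖a‖ < 1 := by simpa using hφmaps (hzb n)
    have hapos : 0 < 1 - ‖a‖ ^ 2 := by nlinarith [norm_nonneg a]
    obtain ⟨m1, m2⟩ := hC _ (kernel_mem ha1)
    have hp := point_bound _ m1 (z n) (hzb n)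
    have hnn : 0 ≤ hardySq (fun w => (1 - (starRingEnd ℂ) a * w)⁻¹) := by
      apply Real.sSup_nonneg
      rintro x ⟨r, -, -, rfl⟩
      have := intervalIntegral.integral_nonneg (μ := volume)
        (f := fun θ : ℝ => ‖(1 - (starRingEnd ℂ) a * (r * Complex.exp ((θ : ℂ) * Complex.I)))⁻¹‖ ^ 2)
        Real.two_pi_pos.le fun _ _ => by positivity
      have := Real.pi_pos
      positivity
    have h1 : C * hardySq (fun w => (1 - (starRingEnd ℂ) a * w)⁻¹) ≤ |C| * (1 - ‖a‖ ^ 2)⁻¹ :=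
      mul_le_mul (le_abs_self C) (kernel_sq ha1) hnn (abs_nonneg C)
    have h2 := (hp.trans m2).trans h1
    rw [← ha, kernel_self, norm_mul, Complex.norm_real, Real.norm_of_nonneg (by positivity),
      mul_pow] at h2
    have h3 : ((1/2 : ℝ) ^ n) ^ 2 * (1 - ‖z n‖ ^ 2)⁻¹ ≤ ‖h (z n)‖ ^ 2 := by
      have := pow_le_pow_left₀ (by have := hpos n; positivity) (hlow n) 2
      refine le_trans (le_of_eq ?_) this
      rw [mul_pow, mul_pow, Real.sq_sqrt (hpos n).le]
      have := (hpos n).ne'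
      field_simp
    have h4 : (1/2 : ℝ) ≤ (1 - ‖z n‖ ^ 2)⁻¹ * (1 - ‖z n‖) := by
      rw [inv_mul_eq_div, le_div_iff₀ (hpos n)]
      nlinarith [hz1 n, norm_nonneg (z n)]
    have h5 : ‖h (z n)‖ ^ 2 * (1 - ‖z n‖) ≤ |C| * (1 - ‖a‖ ^ 2) := by
      have := mul_le_mul_of_nonneg_right h2 (sq_nonneg (1 - ‖a‖ ^ 2))
      have hne := hapos.ne'
      field_simp at this
      linarith
    have h6 : ((1/2 : ℝ) ^ n) ^ 2 * (1/2) ≤ |C| * (1 - ‖a‖ ^ 2) := by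
      refine le_trans ?_ h5
      calc _ ≤ ((1/2 : ℝ) ^ n) ^ 2 * ((1 - ‖z n‖ ^ 2)⁻¹ * (1 - ‖z n‖)) := by gcongr
        _ = ((1/2 : ℝ) ^ n) ^ 2 * (1 - ‖z n‖ ^ 2)⁻¹ * (1 - ‖z n‖) := by ring
        _ ≤ _ := mul_le_mul_of_nonneg_right h3 (by linarith [hz1 n])
    have h7 : 1 - ‖a‖ ^ 2 ≤ 2 * (1/8 : ℝ) ^ n := by
      nlinarith [hzφ n, norm_nonneg a]
    have h8 := h6.trans (mul_le_mul_of_nonneg_left h7 (abs_nonneg C))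
    have h9 := mul_le_mul_of_nonneg_right h8 (by positivity : (0:ℝ) ≤ 8 ^ n)
    have e1 : ((1/2 : ℝ) ^ n) ^ 2 * 8 ^ n = 2 ^ n := by
      rw [← pow_mul, mul_comm n 2, pow_mul, ← mul_pow]; norm_num
    have e2 : (1/8 : ℝ) ^ n * 8 ^ n = 1 := by
      rw [← mul_pow]; norm_num
    have e3 : |C| * (2 * (1/8 : ℝ) ^ n) * 8 ^ n = 2 * |C| := by
      linear_combination (2 * |C|) * e2
    have e4 : ((1/2 : ℝ) ^ n) ^ 2 * (1/2) * 8 ^ n = 2 ^ n / 2 := by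
      linear_combination (1/2) * e1
    rw [e3, e4] at h9
    linarith
  obtain ⟨n, hn⟩ := pow_unbounded_of_one_lt (4 * |C|) (by norm_num : (1:ℝ) < 2)
  exact absurd (hfin n) (not_le.2 hn)
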